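/- Let (P_α)_{α ∈ I} be a family of fields, K = Π_{α ∈ I} P_α, n ≥ 1, and let G be a subgroup of GL_n(K) in which every element is quasi-nil. Then G possesses a locally nilpotent normal subgroup N such that the quotient G/N is solvable. -/

import Mathlib

/-- Engel words with the convention of the paper: the commutator is
`[x, y] = x⁻¹ * y⁻¹ * x * y`, `engelWord 0 x y = x` and
`engelWord (n+1) x y = [engelWord n x y, y]`; thus for `n ≥ 1`,
`engelWord n x y` is the Engel word `e_n(x, y)`. -/
def engelWord {G : Type*} [Group G] : ℕ → G → G → G
  | 0, x, _ => x
  | n + 1, x, y => (engelWord n x y)⁻¹ * y⁻¹ * engelWord n x y * y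

/-- Iterated Engel words: `epsEngel [(n₁,a₁),…,(n_k,a_k)] y` is
`ε_{(n₁,…,n_k)}(a₁,…,a_k; y)`, defined by `ε_{(n₁)}(a₁;y) = e_{n₁}(a₁,y)` and
`ε_{(n₁,…,n_k)}(a₁,…,a_k;y) = e_{n_k}(a_k, ε_{(n₁,…,n_{k-1})}(a₁,…,a_{k-1};y))`. -/
def epsEngel {G : Type*} [Group G] (l : List (ℕ × G)) (y : G) : G :=
  l.foldl (fun z p => engelWord p.1 p.2 z) y

/-- `g` is a nil-element if for every `a` there is `n ≥ 1` with `e_n(a, g) = 1`. -/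
def IsNilElement {G : Type*} [Group G] (g : G) : Prop :=
  ∀ a : G, ∃ n, 1 ≤ n ∧ engelWord n a g = 1

/-- A group is locally nilpotent if every finitely generated subgroup is nilpotent. -/
def LocallyNilpotent (G : Type*) [Group G] : Prop :=
  ∀ H : Subgroup G, H.FG → Group.IsNilpotent H

/-- `g` is quasi-nil of order ≤ `k`: there are functions `ν i : G^(i+1) → ℕ` (with values ≥ 1,
`ν i` depending only on `a₁,…,a_{i+1}` and `g`) such that for all `a : Fin k → G`,
`ε_{(ν₁(a₁),…,ν_k(a₁,…,a_k))}(a₁,…,a_k; g) = 1`. -/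
def IsQuasiNilOfOrder {G : Type*} [Group G] (k : ℕ) (g : G) : Prop :=
  ∃ ν : ∀ i : Fin k, (Fin ((i : ℕ) + 1) → G) → ℕ,
    (∀ i f, 1 ≤ ν i f) ∧
    ∀ a : Fin k → G,
      epsEngel (List.ofFn fun i : Fin k =>
        (ν i fun j => a (Fin.castLE i.isLt j), a i)) g = 1

/-- `g` is quasi-nil if it is quasi-nil of order ≤ `k` for some `k ≥ 1`. -/
def IsQuasiNil {G : Type*} [Group G] (g : G) : Prop :=
  ∃ k, 1 ≤ k ∧ IsQuasiNilOfOrder k g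

/-- `g` maps to a nil-element of the quotient `G ⧸ N` (for `N` normal). -/
def IsNilElementQuot {G : Type*} [Group G] (N : Subgroup G) (hN : N.Normal) (g : G) : Prop :=
  @IsNilElement (G ⧸ N) (@QuotientGroup.Quotient.group G _ N hN) (QuotientGroup.mk g)

/-! ### Quasi-nil elements, recursively -/

/-- A recursive form of being quasi-nil of order at most `k`. -/
def QuasiNilRec {G : Type*} [Group G] : ℕ → G → Prop
  | 0, g => g = 1
  | k + 1, g => ∀ a : G, ∃ n, QuasiNilRec k (engelWord n a g)

theorem IsQuasiNilOfOrder.quasiNilRec {G : Type*} [Group G] {k : ℕ} {g : G}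
    (h : IsQuasiNilOfOrder k g) : QuasiNilRec k g := by
  induction k generalizing g with
  | zero =>
    obtain ⟨_, -, h⟩ := h
    simpa [epsEngel, QuasiNilRec] using h Fin.elim0
  | succ k ih =>
    obtain ⟨ν, hν, h⟩ := h
    intro a
    refine ⟨ν 0 fun _ => a, ih ⟨fun i f => ν i.succ (Fin.cons a f : Fin (i + 1 + 1) → G),
      fun i f => hν _ _, fun b => ?_⟩⟩
    have := h (Fin.cons a b)
    simp only [epsEngel, List.ofFn_succ, List.foldl_cons, Fin.cons_zero, Fin.cons_succ] at this ⊢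
    convert this using 5 with i
    · rw [Fin.fin_one_eq_zero i]
      rfl
    · congr 2
      funext j
      refine Fin.cases ?_ (fun j => ?_) j
      · rfl
      · rfl

theorem map_engelWord {G H : Type*} [Group G] [Group H] (f : G →* H) (n : ℕ) (a g : G) :
    f (engelWord n a g) = engelWord n (f a) (f g) := by
  induction n with
  | zero => rfl
  | succ n ih => simp [engelWord, ih]

theorem QuasiNilRec.map {G H : Type*} [Group G] [Group H] {f : G →* H}
    (hf : Function.Surjective f) {k : ℕ} {g : G} (h : QuasiNilRec k g) :
    QuasiNilRec k (f g) := by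
  induction k generalizing g with
  | zero => simp only [QuasiNilRec] at h ⊢; simp [h]
  | succ k ih =>
    intro b
    obtain ⟨a, rfl⟩ := hf b
    obtain ⟨n, hn⟩ := h a
    exact ⟨n, map_engelWord f n a g ▸ ih hn⟩

theorem QuasiNilRec.of_map {G H : Type*} [Group G] [Group H] {f : G →* H}
    (hf : Function.Injective f) {k : ℕ} {g : G} (h : QuasiNilRec k (f g)) :
    QuasiNilRec k g := by
  induction k generalizing g with
  | zero => exact hf (h.trans (map_one f).symm)
  | succ k ih =>
    intro a
    obtain ⟨n, hn⟩ := h (f a)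
    exact ⟨n, ih (map_engelWord f n a g ▸ hn)⟩

/-- `g` is a left Engel element. -/
def IsLeftEngel {G : Type*} [Group G] (g : G) : Prop :=
  ∀ a : G, ∃ n, engelWord n a g = 1

theorem IsLeftEngel.of_map {G H : Type*} [Group G] [Group H] {f : G →* H}
    (hf : Function.Injective f) {g : G} (h : IsLeftEngel (f g)) : IsLeftEngel g := fun a =>
  (h (f a)).imp fun n hn => hf (by rw [map_engelWord, hn, map_one])

theorem IsLeftEngel.map {G H : Type*} [Group G] [Group H] {f : G →* H}
    (hf : Function.Surjective f) {g : G} (h : IsLeftEngel g) : IsLeftEngel (f g) := fun b => by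
  obtain ⟨a, rfl⟩ := hf b
  exact (h a).imp fun n hn => by rw [← map_engelWord, hn, map_one]

theorem QuasiNilRec.exists_isLeftEngel {G : Type*} [Group G] {k : ℕ} {g : G}
    (h : QuasiNilRec k g) (hg : g ≠ 1) : ∃ x : G, x ≠ 1 ∧ IsLeftEngel x := by
  induction k generalizing g with
  | zero => exact absurd h hg
  | succ k ih =>
    by_cases hnil : IsLeftEngel g
    · exact ⟨g, hg, hnil⟩
    · simp only [IsLeftEngel, not_forall, not_exists] at hnil
      obtain ⟨a, ha⟩ := hnil
      obtain ⟨n, hn⟩ := h a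
      exact ih hn (ha n)

/-! ### Fitting's theorem -/

theorem Subgroup.commutator_iSup_le {G : Type*} [Group G] {ι : Sort*} {X : ι → Subgroup G}
    {Y K : Subgroup G} [K.Normal] (h : ∀ i, ⁅X i, Y⁆ ≤ K) : ⁅⨆ i, X i, Y⁆ ≤ K := by
  have key (Z : Subgroup G) : ⁅Z, Y⁆ ≤ K ↔
      Z ≤ (centralizer (Y.map (QuotientGroup.mk' K) : Set (G ⧸ K))).comap
        (QuotientGroup.mk' K) := by
    rw [← map_le_iff_le_comap, ← commutator_eq_bot_iff_le_centralizer, ← map_commutator,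
      (map_eq_bot_iff _), QuotientGroup.ker_mk']
  exact (key _).2 (iSup_le fun i => (key _).1 (h i))

theorem Subgroup.isNilpotent_sup {G : Type*} [Group G] (A B : Subgroup G) [A.Normal] [B.Normal]
    [Group.IsNilpotent A] [Group.IsNilpotent B] : Group.IsNilpotent ↥(A ⊔ B) := by
  obtain ⟨a, ha⟩ := (isNilpotent_iff_lowerCentralSeries A).1 ‹_›
  obtain ⟨b, hb⟩ := (isNilpotent_iff_lowerCentralSeries B).1 ‹_›
  let s (S : Subgroup G) (n : ℕ) : Subgroup G := if n = 0 then ⊤ else S.lowerCentralSeries (n - 1)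
  have s_normal (S : Subgroup G) [S.Normal] (n : ℕ) : (s S n).Normal := by
    simp only [s]; split_ifs <;> infer_instance
  have s_succ (S : Subgroup G) [S.Normal] (n : ℕ) : ⁅s S n, S⁆ ≤ s S (n + 1) := by
    rcases n with _ | n
    · simpa [s] using commutator_le_right _ _
    · simp [s]
  have s_bot {S : Subgroup G} {c n : ℕ} (hc : S.lowerCentralSeries c = ⊥) (hn : c + 1 ≤ n) :
      s S n = ⊥ := by
    simp only [s, if_neg (by lia : n ≠ 0)]
    exact le_bot_iff.1 (hc ▸ S.lowerCentralSeries_antitone (by lia))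
  let C (n : ℕ) : Subgroup G := ⨆ p : {p : ℕ × ℕ // p.1 + p.2 = n}, s A p.1.1 ⊓ s B p.1.2
  have C_normal (n : ℕ) : (C n).Normal := by
    have := fun p : {p : ℕ × ℕ // p.1 + p.2 = n} => s_normal A p.1.1
    have := fun p : {p : ℕ × ℕ // p.1 + p.2 = n} => s_normal B p.1.2
    exact iSup_normal _
  have le_C {n : ℕ} (i j : ℕ) (h : i + j = n) : s A i ⊓ s B j ≤ C n :=
    le_iSup (fun p : {p : ℕ × ℕ // p.1 + p.2 = n} => s A p.1.1 ⊓ s B p.1.2) ⟨(i, j), h⟩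
  have step (n : ℕ) : ⁅C n, A ⊔ B⁆ ≤ C (n + 1) := by
    refine commutator_iSup_le fun ⟨⟨i, j⟩, h⟩ => ?_
    have := s_normal A
    have := s_normal B
    rw [commutator_comm, sup_eq_iSup]
    refine commutator_iSup_le fun t => ?_
    rw [commutator_comm]
    cases t
    · refine le_trans (le_inf ?_ ?_) (le_C i (j + 1) (by simp at h; lia))
      · exact (commutator_mono inf_le_left le_rfl).trans (commutator_le_left _ _)
      · exact (commutator_mono inf_le_right le_rfl).trans (s_succ B j)
    · refine le_trans (le_inf ?_ ?_) (le_C (i + 1) j (by simp at h; lia))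
      · exact (commutator_mono inf_le_left le_rfl).trans (s_succ A i)
      · exact (commutator_mono inf_le_right le_rfl).trans (commutator_le_left _ _)
  have le (n : ℕ) : (A ⊔ B).lowerCentralSeries n ≤ C n := by
    induction n with
    | zero => exact le_trans le_top (by simpa [s] using le_C 0 0 rfl)
    | succ n ih => exact (commutator_mono ih le_rfl).trans (step n)
  refine isNilpotent_of_lowerCentralSeries_eq_bot (n := a + b + 2) (le_bot_iff.1 ((le _).trans ?_))
  refine iSup_le fun ⟨⟨i, j⟩, h⟩ => ?_
  simp only at h ⊢
  by_cases hi : a + 1 ≤ i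
  · rw [s_bot ha hi]; exact inf_le_left
  · rw [s_bot hb (by lia)]; exact inf_le_right

theorem Subgroup.exists_normal_isNilpotent_forall_le (G : Type*) [Group G] [Finite G] :
    ∃ F : Subgroup G, F.Normal ∧ Group.IsNilpotent F ∧
      ∀ N : Subgroup G, N.Normal → Group.IsNilpotent N → N ≤ F := by
  obtain ⟨F, ⟨hF, hF'⟩, hmax⟩ := (Set.toFinite
    {N : Subgroup G | N.Normal ∧ Group.IsNilpotent N}).exists_maximal
      ⟨⊥, inferInstance, inferInstance⟩
  exact ⟨F, hF, hF', fun N hN hN' => le_sup_right.trans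
    (hmax ⟨inferInstance, isNilpotent_sup F N⟩ le_sup_left)⟩

/-! ### Baer's theorem on left Engel elements of finite groups -/

theorem Subgroup.exists_mem_normalizer_of_lt {G : Type*} [Group G] {D F : Subgroup G}
    [Group.IsNilpotent F] (h : D < F) : ∃ t ∈ F, t ∉ D ∧ t ∈ normalizer (D : Set G) := by
  have hlt : D.subgroupOf F < ⊤ := lt_top_iff_ne_top.2 fun h' =>
    h.not_ge (subgroupOf_eq_top.1 h')
  obtain ⟨t, ht, htD⟩ := SetLike.exists_of_lt
    (Group.normalizerCondition_of_isNilpotent (G := F) _ hlt)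
  refine ⟨t, t.2, htD, mem_normalizer_iff.2 fun d => ?_⟩
  rw [mem_normalizer_iff] at ht
  constructor
  · intro hd
    simpa [mem_subgroupOf] using (ht ⟨d, h.le hd⟩).1 hd
  · intro hd
    have hdF : d ∈ F := by
      have := F.mul_mem (F.mul_mem (F.inv_mem t.2) (h.le hd)) t.2
      simpa [mul_assoc] using this
    exact (ht ⟨d, hdF⟩).2 hd

theorem Subgroup.mem_normalizer_closure_of_forall {G : Type*} [Group G] [Finite G] {S : Set G}
    {t : G} (h : ∀ y ∈ S, t * y * t⁻¹ ∈ closure S) : t ∈ normalizer (closure S : Set G) := by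
  rw [mem_normalizer_iff_map_conj_eq]
  refine eq_of_le_of_card_ge ?_ (card_map_of_injective (MulAut.conj t).injective).ge
  rw [MonoidHom.map_closure, closure_le]
  rintro _ ⟨y, hy, rfl⟩
  exact h y hy

theorem Subgroup.exists_mem_normalizer_closure {G : Type*} [Group G] [Finite G] {F : Subgroup G}
    [Group.IsNilpotent F] {S T : Set G} (hSF : S ⊆ F) (hconj : ∀ t ∈ F, ∀ y ∈ S, t * y * t⁻¹ ∈ S)
    (hTS : T ⊆ S) (hne : ¬ S ⊆ T) :
    ∃ y ∈ S, y ∉ T ∧ y ∈ normalizer (closure T : Set G) := by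
  by_cases hF : F ≤ normalizer (closure T : Set G)
  · obtain ⟨y, hy, hyT⟩ := Set.not_subset.1 hne
    exact ⟨y, hy, hyT, hF (hSF hy)⟩
  obtain ⟨t, htF, htN, ht⟩ := exists_mem_normalizer_of_lt
    (show normalizer (closure T : Set G) ⊓ F < F from
      lt_of_le_of_ne inf_le_right fun h => hF (inf_eq_right.1 h))
  have htD : t ∉ normalizer (closure T : Set G) := fun h => htN ⟨h, htF⟩
  obtain ⟨y, hy, hyT⟩ : ∃ y ∈ T, t * y * t⁻¹ ∉ closure T := by
    by_contra! h
    exact htD (mem_normalizer_closure_of_forall h)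
  have hy' : y ∈ normalizer (closure T : Set G) ⊓ F :=
    ⟨le_normalizer (subset_closure hy), hSF (hTS hy)⟩
  exact ⟨t * y * t⁻¹, hconj t htF y (hTS hy), fun h => hyT (subset_closure h),
    ((mem_normalizer_iff.1 ht y).1 hy').1⟩

theorem Subgroup.eq_of_isCoatom_of_mem_inter {G : Type*} [Group G] [Finite G] {Δ : Set G}
    (hconj : ∀ t, ∀ y ∈ Δ, t * y * t⁻¹ ∈ Δ)
    (hprop : ∀ H : Subgroup G, H ≠ ⊤ → Group.IsNilpotent (closure (Δ ∩ H)))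
    (hΔ : ∀ N : Subgroup G, N.Normal → Group.IsNilpotent N → ∀ y ∈ Δ, y ∉ N)
    {M K : Subgroup G} (hM : IsCoatom M) (hK : IsCoatom K) {y : G} (hy : y ∈ Δ) (hyM : y ∈ M)
    (hyK : y ∈ K) : M = K := by
  by_contra hMK
  let T : Set (Subgroup G × Subgroup G) :=
    {p | IsCoatom p.1 ∧ IsCoatom p.2 ∧ p.1 ≠ p.2 ∧ (Δ ∩ (p.1 ⊓ p.2 : Subgroup G)).Nonempty}
  obtain ⟨⟨A, B⟩, ⟨hA, hB, hAB, z, hz⟩, hmax⟩ := T.exists_max_image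
    (fun p => (Δ ∩ (p.1 ⊓ p.2 : Subgroup G)).ncard) (Set.toFinite _)
      ⟨(M, K), hM, hK, hMK, y, hy, hyM, hyK⟩
  simp only at hA hB hAB hz hmax
  set E : Set G := Δ ∩ (A ⊓ B : Subgroup G) with hE
  have hN : normalizer (closure E : Set G) ≠ ⊤ := fun h => by
    have hnil : Group.IsNilpotent (closure E) :=
      hprop (A ⊓ B) fun h => hA.1 (top_le_iff.1 (h ▸ inf_le_left))
    exact hΔ _ (normalizer_eq_top_iff.1 h) hnil z hz.1 (subset_closure hz)
  obtain ⟨L, hL, hNL⟩ := (eq_top_or_exists_le_coatom _).resolve_left hN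
  have hEL : (E : Set G) ⊆ L := subset_closure.trans (le_normalizer.trans hNL)
  have key (C C' : Subgroup G) (hC : IsCoatom C) (hCE : E = Δ ∩ (C ⊓ C' : Subgroup G)) :
      C = L := by
    by_contra hCL
    have hsub : E ⊆ Δ ∩ (C ⊓ L : Subgroup G) := fun e he =>
      ⟨he.1, (hCE ▸ he).2.1, hEL he⟩
    have hle := hmax (C, L) ⟨hC, hL, hCL, z, hsub hz⟩
    have heq : E = Δ ∩ (C ⊓ L : Subgroup G) :=
      Set.eq_of_subset_of_ncard_le hsub hle (Set.toFinite _)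
    have hCL' : ¬ C ≤ L := fun h => hCL (hC.le_iff.1 h |>.resolve_left hL.1).symm
    have hEC : E ⊆ C := fun e he => (hCE ▸ he).2.1
    by_cases hΔC : Δ ∩ C ⊆ E
    · refine hCL' (le_trans (fun c hc => mem_normalizer_closure_of_forall fun e he => ?_) hNL)
      exact subset_closure (hΔC ⟨hconj c e he.1,
        C.mul_mem (C.mul_mem hc (hEC he)) (C.inv_mem hc)⟩)
    · have := hprop C hC.1
      obtain ⟨w, hw, hwE, hwN⟩ := exists_mem_normalizer_closure (F := closure (Δ ∩ C))
        (S := Δ ∩ C) (T := E) subset_closure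
        (fun t ht s hs => ⟨hconj t s hs.1, by
          have htC : t ∈ C := (closure_le C).2 Set.inter_subset_right ht
          exact C.mul_mem (C.mul_mem htC hs.2) (C.inv_mem htC)⟩)
        (fun e he => ⟨he.1, hEC he⟩) hΔC
      exact hwE (heq ▸ ⟨hw.1, hw.2, hNL hwN⟩)
  exact hAB ((key A B hA rfl).trans (key B A hB (by rw [hE, inf_comm])).symm)

/-- Baer: a left Engel element of a finite group lies in a nilpotent normal subgroup. -/
theorem IsLeftEngel.exists_normal_isNilpotent {G : Type*} [Group G] [Finite G] {x : G}
    (hx : IsLeftEngel x) : ∃ N : Subgroup G, N.Normal ∧ Group.IsNilpotent N ∧ x ∈ N := by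
  induction hn : Nat.card G using Nat.strong_induction_on generalizing G with
  | _ n ih =>
  subst hn
  by_contra! hcon
  let Δ : Set G := {y | IsConj x y}
  have hconj : ∀ t, ∀ y ∈ Δ, t * y * t⁻¹ ∈ Δ := fun t y hy =>
    IsConj.trans (b := y) hy (isConj_iff.2 ⟨t, rfl⟩)
  have hengel : ∀ y ∈ Δ, IsLeftEngel y := fun y hy => by
    obtain ⟨c, rfl⟩ := isConj_iff.1 hy
    exact hx.map (f := (MulAut.conj c).toMonoidHom) (MulAut.conj c).surjective
  have hprop (H : Subgroup G) (hH : H ≠ ⊤) :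
      Group.IsNilpotent (Subgroup.closure (Δ ∩ H)) := by
    obtain ⟨F, hF, hFn, hFmax⟩ := Subgroup.exists_normal_isNilpotent_forall_le H
    have hcard : Nat.card H < Nat.card G :=
      lt_of_le_of_ne H.card_le_card_group fun h => hH (H.card_eq_iff_eq_top.1 h)
    have hle : Subgroup.closure (Δ ∩ H) ≤ F.map H.subtype := by
      rw [Subgroup.closure_le]
      rintro y ⟨hy, hyH⟩
      obtain ⟨N, hN, hNn, hyN⟩ := ih _ hcard (x := (⟨y, hyH⟩ : H))
        (IsLeftEngel.of_map (f := H.subtype) H.subtype_injective (hengel y hy)) rfl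
      exact ⟨⟨y, hyH⟩, hFmax N hN hNn hyN, rfl⟩
    have : Group.IsNilpotent (F.map H.subtype) :=
      Group.nilpotent_of_mulEquiv (F.equivMapOfInjective _ H.subtype_injective)
    exact (Group.isNilpotent_congr (Subgroup.subgroupOfEquivOfLe hle)).1 inferInstance
  have hΔ (N : Subgroup G) (hN : N.Normal) (hNn : Group.IsNilpotent N) : ∀ y ∈ Δ, y ∉ N := by
    intro y hy hyN
    obtain ⟨c, rfl⟩ := isConj_iff.1 hy
    refine hcon N hN hNn ?_
    simpa [mul_assoc] using hN.conj_mem _ hyN c⁻¹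
  have hxΔ : x ∈ Δ := IsConj.refl x
  have hcyc : Subgroup.zpowers x ≠ ⊤ := fun h => by
    have hz : Group.IsNilpotent (Subgroup.zpowers x) :=
      @CommGroup.isNilpotent _ IsCyclic.commGroup
    rw [h] at hz
    exact hΔ ⊤ inferInstance hz x hxΔ trivial
  obtain ⟨M, hM, hxM⟩ := (eq_top_or_exists_le_coatom _).resolve_left hcyc
  replace hxM : x ∈ M := hxM (Subgroup.mem_zpowers x)
  have hMnorm : Subgroup.normalizer (M : Set G) = M := by
    by_contra hne
    have hMn := Subgroup.normalizer_eq_top_iff.1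
      (hM.2 _ (lt_of_le_of_ne Subgroup.le_normalizer (Ne.symm hne)))
    refine hΔ (Subgroup.closure (Δ ∩ M)) ?_ (hprop M hM.1) x hxΔ
      (Subgroup.subset_closure ⟨hxΔ, hxM⟩)
    refine Subgroup.normalizer_eq_top_iff.1 (top_le_iff.1 fun t _ =>
      Subgroup.mem_normalizer_closure_of_forall fun y hy => Subgroup.subset_closure ?_)
    exact ⟨hconj t y hy.1, hMn.conj_mem y hy.2 t⟩
  obtain ⟨g, hg⟩ : ∃ g, g ∉ M := by
    by_contra! h
    exact hM.1 ((Subgroup.eq_top_iff' M).2 h)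
  have mem_of_succ (n : ℕ) (h : engelWord (n + 1) g x ∈ M) : engelWord n g x ∈ M := by
    set c := engelWord n g x with hc
    have hcx : c⁻¹ * x * c ∈ M := by
      have h1 : c⁻¹ * x⁻¹ * c * x ∈ M := h
      have h2 := M.inv_mem (M.mul_mem h1 (M.inv_mem hxM))
      simpa [mul_assoc] using h2
    have hcoatom : IsCoatom (M.map (MulAut.conj c).toMonoidHom) :=
      ((MulAut.conj c).mapSubgroup.isCoatom_iff M).2 hM
    have heq := Subgroup.eq_of_isCoatom_of_mem_inter hconj hprop hΔ hcoatom hM hxΔ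
      ⟨_, hcx, by simp [mul_assoc]⟩ hxM
    rw [← hMnorm]
    exact Subgroup.mem_normalizer_iff_map_conj_eq.2 heq
  obtain ⟨m, hm⟩ := hx g
  have hall (k : ℕ) (h : engelWord k g x ∈ M) : g ∈ M := by
    induction k with
    | zero => exact h
    | succ k ih => exact ih (mem_of_succ k h)
  exact hg (hall m (hm ▸ M.one_mem))

theorem isSolvable_of_forall_quasiNilRec {G : Type*} [Group G] [Finite G]
    (h : ∀ g : G, ∃ k, QuasiNilRec k g) : Group.IsSolvable G := by
  induction hn : Nat.card G using Nat.strong_induction_on generalizing G with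
  | _ n ih =>
  subst hn
  by_cases hG : Subsingleton G
  · infer_instance
  have := not_subsingleton_iff_nontrivial.1 hG
  obtain ⟨g, hg⟩ := exists_ne (1 : G)
  obtain ⟨k, hk⟩ := h g
  obtain ⟨x, hx1, hx⟩ := hk.exists_isLeftEngel hg
  obtain ⟨N, hN, hNn, hxN⟩ := hx.exists_normal_isNilpotent
  have hN1 : N ≠ ⊥ := fun h => hx1 (by simpa [h] using hxN)
  have hcard : Nat.card (G ⧸ N) < Nat.card G := by
    rw [N.card_eq_card_quotient_mul_card_subgroup]
    exact lt_mul_of_one_lt_right Nat.card_pos (N.one_lt_card_iff_ne_bot.2 hN1)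
  have hquot : Group.IsSolvable (G ⧸ N) := ih _ hcard (fun q => by
    obtain ⟨g, rfl⟩ := QuotientGroup.mk'_surjective N q
    exact (h g).imp fun k hk => hk.map (QuotientGroup.mk'_surjective N)) rfl
  exact (Group.isSolvable_iff_subgroup_quotient N).2 ⟨inferInstance, hquot⟩

/-! ### Zassenhaus' bound on the derived length of solvable linear groups -/

theorem derivedSeries_add_le_map_subtype {G : Type*} [Group G] {D : Subgroup G} {m : ℕ}
    (h : derivedSeries G m ≤ D) (n : ℕ) :
    derivedSeries G (m + n) ≤ (derivedSeries D n).map D.subtype := by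
  induction n with
  | zero => simpa [← MonoidHom.range_eq_map] using h
  | succ n ih =>
    rw [← add_assoc, derivedSeries_succ, derivedSeries_succ, Subgroup.map_commutator]
    exact Subgroup.commutator_mono ih ih

theorem derivedSeries_add_le_ker {G M : Type*} [Group G] [MulOneClass M] (f : G →* M)
    {D : Subgroup G} {m n : ℕ} (h : derivedSeries G m ≤ D)
    (hD : derivedSeries D n ≤ (f.comp D.subtype).ker) : derivedSeries G (m + n) ≤ f.ker := by
  refine (derivedSeries_add_le_map_subtype h n).trans ?_
  rintro _ ⟨d, hd, rfl⟩
  exact hD hd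

theorem derivedSeries_natCard_eq_bot (G : Type*) [Group G] [Finite G] [Group.IsSolvable G] :
    derivedSeries G (Nat.card G) = ⊥ := by
  have key (n : ℕ) : derivedSeries G n = ⊥ ∨ Nat.card (derivedSeries G n) + n ≤ Nat.card G := by
    induction n with
    | zero => right; simp
    | succ n ih =>
      by_cases hn : derivedSeries G n = ⊥
      · left; rw [derivedSeries_succ, hn, Subgroup.commutator_bot_left]
      · right
        have hlt := Group.IsSolvable.commutator_lt_of_ne_bot hn
        have hcard : Nat.card (derivedSeries G (n + 1)) < Nat.card (derivedSeries G n) :=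
          Set.ncard_lt_ncard hlt (Set.toFinite _)
        have := ih.resolve_left hn
        lia
  refine (key _).resolve_right fun h => ?_
  have : 0 < Nat.card (derivedSeries G (Nat.card G)) := Nat.card_pos
  lia

theorem derivedSeries_le_ker_of_card_le {G H : Type*} [Group G] [Group.IsSolvable G] [Group H]
    [Finite H] (f : G →* H) {m : ℕ} (hm : Nat.card H ≤ m) : derivedSeries G m ≤ f.ker := by
  have hsol : Group.IsSolvable f.range :=
    Group.isSolvable_of_surjective f.rangeRestrict_surjective
  have h1 : derivedSeries f.range m = ⊥ := by
    refine le_bot_iff.1 (le_trans (derivedSeries_antitone _ ?_)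
      (derivedSeries_natCard_eq_bot f.range).le)
    exact f.range.card_le_card_group.trans hm
  intro g hg
  have h2 : f.rangeRestrict g ∈ derivedSeries f.range m :=
    map_derivedSeries_le_derivedSeries f.rangeRestrict m ⟨g, hg, rfl⟩
  rw [h1, Subgroup.mem_bot] at h2
  exact congrArg Subtype.val h2

namespace Representation

variable {F G V : Type*} [Field F] [Group G] [AddCommGroup V] [Module F V]

/-- The weights of the normal subgroup `A` on the representation `ρ`. -/
def weights (ρ : Representation F G V) (A : Subgroup G) : Set (A → F) :=
  {χ | ∃ v : V, v ≠ 0 ∧ ∀ a : A, ρ a v = χ a • v}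

theorem linearIndependent_weights (ρ : Representation F G V) (A : Subgroup G)
    (v : ρ.weights A → V) (hv : ∀ χ, v χ ≠ 0) (h : ∀ χ (a : A), ρ a (v χ) = χ.1 a • v χ) :
    LinearIndependent F v := by
  classical
  rw [linearIndependent_iff']
  intro s
  induction s using Finset.induction_on with
  | empty => simp
  | insert χ₀ s hχ₀ ih =>
    intro c hc
    have hs : ∀ χ ∈ s, c χ = 0 := by
      intro χ hχ
      by_contra hcχ
      have hne : χ ≠ χ₀ := fun h => hχ₀ (h ▸ hχ)
      refine hne (Subtype.ext (funext fun a => ?_))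
      have h1 : ∑ i ∈ s, (c i * (i.1 a - χ₀.1 a)) • v i = 0 := by
        have h2 := congrArg (fun w => ρ a w - χ₀.1 a • w) hc
        simp only [map_sum, map_smul, h, Finset.smul_sum, ← Finset.sum_sub_distrib, map_zero,
          smul_zero, sub_zero] at h2
        rw [Finset.sum_insert hχ₀] at h2
        rw [← h2, smul_comm (c χ₀), sub_self, zero_add]
        refine Finset.sum_congr rfl fun i _ => ?_
        rw [smul_smul, smul_smul, ← sub_smul]
        ring_nf
      have h3 := ih _ h1 χ hχ
      exact sub_eq_zero.1 ((mul_eq_zero.1 h3).resolve_left hcχ)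
    intro χ hχ
    rcases Finset.mem_insert.1 hχ with rfl | hχ
    · rw [Finset.sum_insert hχ₀, Finset.sum_eq_zero (fun i hi => by rw [hs i hi, zero_smul]),
        add_zero] at hc
      exact (smul_eq_zero.1 hc).resolve_right (hv _)
    · exact hs χ hχ

theorem finite_weights [FiniteDimensional F V] (ρ : Representation F G V) (A : Subgroup G) :
    Finite (ρ.weights A) ∧ Nat.card (ρ.weights A) ≤ Module.finrank F V := by
  choose v hv h using fun χ : ρ.weights A => χ.2
  have hli := ρ.linearIndependent_weights A v hv h
  have := hli.finite
  have := Fintype.ofFinite (ρ.weights A)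
  exact ⟨‹_›, Nat.card_eq_fintype_card (α := ρ.weights A) ▸ hli.fintype_card_le_finrank⟩

theorem weights_conj_mem (ρ : Representation F G V) (A : Subgroup G) [A.Normal] (g : G)
    {χ : A → F} (hχ : χ ∈ ρ.weights A) :
    (fun a => χ (MulAut.conjNormal g⁻¹ a)) ∈ ρ.weights A := by
  obtain ⟨v, hv, h⟩ := hχ
  refine ⟨ρ g v, fun h0 => hv ?_, fun a => ?_⟩
  · simpa using congrArg (ρ g⁻¹) h0
  · have := congrArg (ρ g) (h (MulAut.conjNormal g⁻¹ a))
    rw [map_smul] at this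
    rw [← this, ← Module.End.mul_apply, ← Module.End.mul_apply, ← map_mul, ← map_mul]
    simp [mul_assoc]

/-- The permutation action of the group on the weights of a normal subgroup. -/
def weightsPerm (ρ : Representation F G V) (A : Subgroup G) [A.Normal] :
    G →* Equiv.Perm (ρ.weights A) :=
  letI : MulAction G (ρ.weights A) :=
    { smul g χ := ⟨_, ρ.weights_conj_mem A g χ.2⟩
      one_smul χ := Subtype.ext (funext fun a => by
        change χ.1 (MulAut.conjNormal 1⁻¹ a) = _
        simp)
      mul_smul g h χ := Subtype.ext (funext fun a => by
        change χ.1 (MulAut.conjNormal (g * h)⁻¹ a) =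
          χ.1 (MulAut.conjNormal h⁻¹ (MulAut.conjNormal g⁻¹ a))
        simp [mul_inv_rev]) }
  MulAction.toPermHom G (ρ.weights A)

open Nat in
theorem exists_subgroup_fixing_weights [FiniteDimensional F V] [Group.IsSolvable G]
    (ρ : Representation F G V) (A : Subgroup G) [A.Normal] {m : ℕ}
    (hm : Module.finrank F V ≤ m) :
    ∃ K : Subgroup G, derivedSeries G (m !) ≤ K ∧
      ∀ k ∈ K, ∀ χ ∈ ρ.weights A, ∀ a : A, χ (MulAut.conjNormal k⁻¹ a) = χ a := by
  obtain ⟨_, hcard⟩ := ρ.finite_weights A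
  refine ⟨(ρ.weightsPerm A).ker, derivedSeries_le_ker_of_card_le _ ?_, fun k hk χ hχ a => ?_⟩
  · rw [Nat.card_perm]
    exact Nat.factorial_le (hcard.trans hm)
  · exact congrFun (congrArg Subtype.val (Equiv.congr_fun (MonoidHom.mem_ker.1 hk) ⟨χ, hχ⟩)) a

/-- The elements of the group whose action commutes with all operators in `S`. -/
def commutant (ρ : Representation F G V) (S : Set (Module.End F V)) : Subgroup G where
  carrier := {g | ∀ T ∈ S, ρ g * T = T * ρ g}
  one_mem' := by simp
  mul_mem' {g h} hg hh T hT := by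
    rw [map_mul, mul_assoc, hh T hT, ← mul_assoc, hg T hT, mul_assoc]
  inv_mem' {g} hg T hT := by
    have h1 : ρ g⁻¹ * ρ g = 1 := by rw [← map_mul, inv_mul_cancel, map_one]
    have h2 : ρ g * ρ g⁻¹ = 1 := by rw [← map_mul, mul_inv_cancel, map_one]
    calc ρ g⁻¹ * T = ρ g⁻¹ * (T * ρ g) * ρ g⁻¹ := by rw [mul_assoc, mul_assoc, h2, mul_one]
      _ = T * ρ g⁻¹ := by rw [← hg T hT, ← mul_assoc, h1, one_mul]

theorem commutant_normal (ρ : Representation F G V) {S : Set (Module.End F V)}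
    (hS : ∀ g, ∀ T ∈ S, ρ g * T * ρ g⁻¹ ∈ S) : (ρ.commutant S).Normal where
  conj_mem x hx g T hT := by
    have h1 : ρ g⁻¹ * ρ g = 1 := by rw [← map_mul, inv_mul_cancel, map_one]
    have h2 : ρ g * ρ g⁻¹ = 1 := by rw [← map_mul, mul_inv_cancel, map_one]
    have h := hx _ (hS g⁻¹ T hT)
    rw [inv_inv] at h
    calc ρ (g * x * g⁻¹) * T = ρ g * (ρ x * (ρ g⁻¹ * T * ρ g)) * ρ g⁻¹ := by
          simp only [map_mul, mul_assoc, h2, mul_one]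
      _ = T * ρ (g * x * g⁻¹) := by
          rw [h]
          simp only [map_mul, ← mul_assoc, h2, one_mul]

/-- The elements acting by scalars, i.e. centrally. -/
abbrev scalars (ρ : Representation F G V) : Subgroup G := ρ.commutant Set.univ

instance (ρ : Representation F G V) : ρ.scalars.Normal :=
  ρ.commutant_normal fun _ _ _ => Set.mem_univ _

theorem mem_scalars_of_forall {ρ : Representation F G V} {g : G} {c : F}
    (h : ∀ v, ρ g v = c • v) : g ∈ ρ.scalars := fun T _ => by
  ext v
  simp [h]

theorem exists_eq_smul_of_mem_scalars {ρ : Representation F G V} {g : G}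
    (h : g ∈ ρ.scalars) : ∃ c : F, ∀ v, ρ g v = c • v := by
  obtain ⟨c, hc⟩ := Algebra.IsCentral.mem_center_iff F (D := Module.End F V) |>.1
    (Subalgebra.mem_center_iff.2 fun T => (h T (Set.mem_univ T)).symm)
  exact ⟨c, fun v => by rw [hc, Module.algebraMap_end_apply]⟩

theorem exists_common_eigenvector {ι : Type*} [IsAlgClosed F] [FiniteDimensional F V]
    [Nontrivial V] (T : ι → Module.End F V) (hT : ∀ i j, T i * T j = T j * T i) :
    ∃ (χ : ι → F) (v : V), v ≠ 0 ∧ ∀ i, T i v = χ i • v := by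
  induction hn : Module.finrank F V using Nat.strong_induction_on generalizing V with
  | _ n ih =>
  subst hn
  by_cases hall : ∀ i, ∃ c : F, ∀ v, T i v = c • v
  · choose χ hχ using hall
    obtain ⟨v, hv⟩ := exists_ne (0 : V)
    exact ⟨χ, v, hv, fun i => hχ i v⟩
  · push Not at hall
    obtain ⟨i, hi⟩ := hall
    obtain ⟨c, hc⟩ := Module.End.exists_eigenvalue (T i)
    have hinv (j : ι) : ∀ w ∈ Module.End.eigenspace (T i) c, T j w ∈ Module.End.eigenspace (T i) c := fun w hw => by
      rw [Module.End.mem_eigenspace_iff] at hw ⊢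
      rw [← Module.End.mul_apply, hT, Module.End.mul_apply, hw, map_smul]
    have hlt : Module.finrank F (Module.End.eigenspace (T i) c) < Module.finrank F V := by
      refine Submodule.finrank_lt fun htop => ?_
      obtain ⟨v, hv⟩ := hi c
      exact hv (Module.End.mem_eigenspace_iff.1 (htop ▸ Submodule.mem_top))
    have : Nontrivial (Module.End.eigenspace (T i) c) := Submodule.nontrivial_iff_ne_bot.2 hc
    obtain ⟨χ, w, hw, h⟩ := ih _ hlt (fun j => (T j).restrict (hinv j)) (fun j k => by
      ext w
      exact congrArg (fun S : Module.End F V => S w) (hT j k)) rfl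
    exact ⟨χ, w, fun h0 => hw (Subtype.ext h0), fun j => congrArg Subtype.val (h j)⟩

theorem derivedSeries_succ_le_ker_of_invariant (ρ : Representation F G V) (W : Submodule F V)
    (hW : ∀ g, W ≤ W.comap (ρ g)) {n : ℕ}
    (h₁ : derivedSeries G n ≤ (ρ.subrepresentation W hW).ker)
    (h₂ : derivedSeries G n ≤ (ρ.quotient W hW).ker) :
    derivedSeries G (n + 1) ≤ ρ.ker := by
  have hsub {g : G} (hg : g ∈ derivedSeries G n) (w : V) (hw : w ∈ W) : ρ g w = w :=
    congrArg Subtype.val (LinearMap.congr_fun (MonoidHom.mem_ker.1 (h₁ hg)) ⟨w, hw⟩)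
  have hquot {g : G} (hg : g ∈ derivedSeries G n) (v : V) : ρ g v - v ∈ W := by
    have := LinearMap.congr_fun (MonoidHom.mem_ker.1 (h₂ hg)) (W.mkQ v)
    exact (Submodule.Quotient.eq W).1 this
  have key {g h : G} (hg : g ∈ derivedSeries G n) (hh : h ∈ derivedSeries G n) (v : V) :
      ρ (g * h) v = ρ g v + ρ h v - v := by
    have := hsub hg _ (hquot hh v)
    rw [map_sub, sub_eq_iff_eq_add] at this
    rw [map_mul, Module.End.mul_apply, this]
    abel
  rw [derivedSeries_succ, Subgroup.commutator_le]
  intro g hg h hh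
  have hcomm : ρ (g * h) = ρ (h * g) := by
    ext v
    rw [key hg hh, key hh hg, add_comm]
  rw [MonoidHom.mem_ker, commutatorElement_def,
    show g * h * g⁻¹ * h⁻¹ = g * h * (h * g)⁻¹ by group, map_mul, hcomm, ← map_mul,
    mul_inv_cancel, map_one]

end Representation

open Nat in
/-- A bound on the derived length of solvable linear groups of degree `n`. -/
def zassenhausBound : ℕ → ℕ
  | 0 => 0
  | n + 1 => ((n + 1) ^ 2)! + 1 + (zassenhausBound n + 1)

namespace Representation

open scoped commutatorElement

universe u v w

/-- Zassenhaus: solvable linear groups have derived length bounded in terms of the degree. -/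
theorem derivedSeries_zassenhausBound_le_ker {F : Type u} [Field F] [IsAlgClosed F] (n : ℕ)
    {V : Type v} [AddCommGroup V] [Module F V] [FiniteDimensional F V]
    {G : Type w} [Group G] [Group.IsSolvable G] (ρ : Representation F G V)
    (hn : Module.finrank F V ≤ n) : derivedSeries G (zassenhausBound n) ≤ ρ.ker := by
  induction n generalizing V G with
  | zero =>
    have := Module.finrank_zero_iff.1 (Nat.le_zero.1 hn)
    intro g _
    rw [MonoidHom.mem_ker]
    exact LinearMap.ext fun v => Subsingleton.elim _ _
  | succ n ih =>
  have reducible (D : Subgroup G) (W : Submodule F V) (hbot : W ≠ ⊥) (htop : W ≠ ⊤)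
      (hW : ∀ d ∈ D, W ≤ W.comap (ρ d)) :
      derivedSeries D (zassenhausBound n + 1) ≤ (ρ.comp D.subtype).ker := by
    refine derivedSeries_succ_le_ker_of_invariant (ρ.comp D.subtype) W (fun d => hW d d.2)
      (ih _ ?_) (ih _ ?_)
    · have := Submodule.finrank_lt htop
      lia
    · have h1 := W.finrank_quotient_add_finrank
      have h2 := Submodule.one_le_finrank_iff.2 hbot
      lia
  by_cases hscal : ∀ g, g ∈ ρ.scalars
  · refine le_trans (derivedSeries_antitone G (show 1 ≤ zassenhausBound (n + 1) by
      simp only [zassenhausBound]; lia)) ?_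
    rw [derivedSeries_one, commutator_def, Subgroup.commutator_le]
    intro g _ h _
    have hcomm : ρ (g * h) = ρ (h * g) := by
      rw [map_mul, map_mul, hscal g _ (Set.mem_univ _)]
    rw [MonoidHom.mem_ker, commutatorElement_def,
      show g * h * g⁻¹ * h⁻¹ = g * h * (h * g)⁻¹ by group, map_mul, hcomm, ← map_mul,
      mul_inv_cancel, map_one]
  have hV : Nontrivial V := by
    by_contra hV
    rw [not_nontrivial_iff_subsingleton] at hV
    exact hscal fun g T _ => LinearMap.ext fun v => Subsingleton.elim _ _
  obtain ⟨A, hAn, hA, hAA⟩ : ∃ A : Subgroup G, A.Normal ∧ ¬ A ≤ ρ.scalars ∧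
      ⁅A, A⁆ ≤ ρ.scalars := by
    classical
    have hex : ∃ m, derivedSeries G m ≤ ρ.scalars := by
      obtain ⟨m, hm⟩ := (Group.isSolvable_def G).1 inferInstance
      exact ⟨m, hm.le.trans bot_le⟩
    have h0 : Nat.find hex ≠ 0 := fun h0 => hscal fun g => by
      have := Nat.find_spec hex
      rw [h0] at this
      exact this (Subgroup.mem_top g)
    obtain ⟨m, hm⟩ := Nat.exists_eq_succ_of_ne_zero h0
    exact ⟨derivedSeries G m, inferInstance, Nat.find_min hex (by lia), by
      have := Nat.find_spec hex
      rwa [hm, Nat.succ_eq_add_one, derivedSeries_succ] at this⟩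
  let C : Subgroup G := ρ.commutant (ρ '' A)
  have hCn : C.Normal := ρ.commutant_normal fun g T hT => by
    obtain ⟨a, ha, rfl⟩ := hT
    exact ⟨g * a * g⁻¹, hAn.conj_mem a ha g, by simp only [map_mul]⟩
  by_cases hB : A ⊓ C ≤ ρ.scalars
  · -- every element of `A` is a weight vector for the conjugation action on `End V`
    obtain ⟨K, hK, hfix⟩ := (linHom ρ ρ).exists_subgroup_fixing_weights A
      (m := (n + 1) ^ 2) (by
        rw [Module.finrank_linearMap, ← sq]
        exact Nat.pow_le_pow_left hn 2)
    have hKA {k : G} (hk : k ∈ K) {b : G} (hb : b ∈ A) : b⁻¹ * (k⁻¹ * b * k) ∈ ρ.scalars := by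
      have hbk : k⁻¹ * b * k ∈ A := by simpa using hAn.conj_mem b hb k⁻¹
      refine hB ⟨A.mul_mem (A.inv_mem hb) hbk, ?_⟩
      rintro _ ⟨a, ha, rfl⟩
      have hcomm (b : A) : ∃ c : F, ∀ v, ρ ⁅(b : G), a⁆ v = c • v :=
        exists_eq_smul_of_mem_scalars (hAA (Subgroup.commutator_mem_commutator b.2 ha))
      choose χ hχ using hcomm
      have hconj (b : A) : ρ b * ρ a * ρ (b : G)⁻¹ = χ b • ρ a := by
        ext v
        have : ρ (b * a * (b : G)⁻¹) v = ρ (⁅(b : G), a⁆ * a) v := by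
          rw [commutatorElement_def]; simp
        simpa [hχ] using this
      have hmem : χ ∈ (linHom ρ ρ).weights A := by
        refine ⟨ρ a, fun h0 => ?_, fun b => hconj b⟩
        obtain ⟨v, hv⟩ := exists_ne (0 : V)
        refine hv ?_
        have := ρ.inv_self_apply a v
        simpa [h0] using this.symm
      have h := hfix k hk χ hmem ⟨b, hb⟩
      have h1 := hconj (MulAut.conjNormal k⁻¹ ⟨b, hb⟩)
      rw [h, ← hconj] at h1
      simp only [MulAut.conjNormal_apply, inv_inv] at h1
      simp only [← map_mul] at h1 ⊢
      have h2 := congrArg (fun T => ρ b⁻¹ * T * ρ (k⁻¹ * b * k)) h1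
      simp only [← map_mul] at h2
      convert h2 using 2 <;> group
    have hKC : derivedSeries G (((n + 1) ^ 2).factorial + 1) ≤ C := by
      rw [derivedSeries_succ, Subgroup.commutator_le]
      intro k hk l hl
      replace hk := hK hk
      replace hl := hK hl
      rintro _ ⟨b, hb, rfl⟩
      have hz {k l : G} (hk : k ∈ K) (hl : l ∈ K) : ρ ((k * l)⁻¹ * b * (k * l)) =
          ρ b * ρ (b⁻¹ * (l⁻¹ * b * l)) * ρ (b⁻¹ * (k⁻¹ * b * k)) := by
        have h1 := hKA hk hb (ρ l) (Set.mem_univ _)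
        calc _ = ρ l⁻¹ * ρ b * (ρ (b⁻¹ * (k⁻¹ * b * k)) * ρ l) := by
              simp only [← map_mul]; congr 1; group
          _ = _ := by
              rw [h1]; simp only [← map_mul]; congr 1; group
      have h3 : ρ ((k * l)⁻¹ * b * (k * l)) = ρ ((l * k)⁻¹ * b * (l * k)) := by
        rw [hz hk hl, hz hl hk, mul_assoc (ρ b), hKA hl hb _ (Set.mem_univ _), mul_assoc (ρ b)]
      have h4 := congrArg (fun T => ρ (k * l) * T * ρ (l * k)⁻¹) h3
      simp only [← map_mul] at h4 ⊢
      convert h4.symm using 2 <;> simp only [commutatorElement_def] <;> group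
    refine derivedSeries_add_le_ker ρ hKC ?_
    obtain ⟨a, ha, has⟩ := SetLike.not_le_iff_exists.1 hA
    obtain ⟨c, hc⟩ := Module.End.exists_eigenvalue (ρ a)
    refine reducible C (Module.End.eigenspace (ρ a) c) hc (fun htop => has ?_) fun d hd w hw => ?_
    · exact mem_scalars_of_forall (c := c) fun v =>
        Module.End.mem_eigenspace_iff.1 (htop ▸ Submodule.mem_top)
    · rw [Submodule.mem_comap]
      rw [Module.End.mem_eigenspace_iff] at hw ⊢
      rw [← Module.End.mul_apply, ← hd _ ⟨a, ha, rfl⟩, Module.End.mul_apply, hw, map_smul]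
  · -- `A ⊓ C` is abelian modulo the kernel and does not consist of scalars
    obtain ⟨K, hK, hfix⟩ := ρ.exists_subgroup_fixing_weights (A ⊓ C)
      (m := (n + 1) ^ 2) (hn.trans (Nat.le_self_pow two_ne_zero _))
    obtain ⟨b, hb, hbs⟩ := SetLike.not_le_iff_exists.1 hB
    obtain ⟨χ, v, hv, hχ⟩ := exists_common_eigenvector (fun b : ↥(A ⊓ C) => ρ b)
      (fun i j => i.2.2 _ ⟨j, j.2.1, rfl⟩)
    have hKs : derivedSeries G (((n + 1) ^ 2).factorial + 1) ≤ K :=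
      (derivedSeries_antitone G (Nat.le_succ _)).trans hK
    refine derivedSeries_add_le_ker ρ hKs ?_
    have hmem (w : V) : w ∈ ⨅ b : ↥(A ⊓ C), Module.End.eigenspace (ρ b) (χ b) ↔
        ∀ b : ↥(A ⊓ C), ρ b w = χ b • w := by
      simp only [Submodule.mem_iInf, Module.End.mem_eigenspace_iff]
    refine reducible K (⨅ b : ↥(A ⊓ C), Module.End.eigenspace (ρ b) (χ b)) (fun hbot => hv ?_)
      (fun htop => hbs ?_) fun k hk w hw => ?_
    · have := (hmem v).2 hχ
      rwa [hbot, Submodule.mem_bot] at this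
    · exact mem_scalars_of_forall (c := χ ⟨b, hb⟩) fun w =>
        (hmem w).1 (htop ▸ Submodule.mem_top) ⟨b, hb⟩
    · rw [Submodule.mem_comap, hmem]
      rw [hmem] at hw
      intro b
      rw [← hfix k hk χ ⟨v, hv, hχ⟩ b, ← map_smul, ← hw, ← Module.End.mul_apply,
        ← Module.End.mul_apply, ← map_mul, ← map_mul]
      simp [mul_assoc]

end Representation

/-! ### Reduction to finite linear groups -/

theorem map_subtype_derivedSeries_mono {G : Type*} [Group G] {H K : Subgroup G} (h : H ≤ K)
    (d : ℕ) : (derivedSeries H d).map H.subtype ≤ (derivedSeries K d).map K.subtype := by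
  rintro _ ⟨x, hx, rfl⟩
  exact ⟨Subgroup.inclusion h x, map_derivedSeries_le_derivedSeries _ d ⟨x, hx, rfl⟩, rfl⟩

theorem exists_fg_mem_map_derivedSeries {G : Type*} [Group G] {d : ℕ} {x : G}
    (hx : x ∈ derivedSeries G d) :
    ∃ H : Subgroup G, H.FG ∧ x ∈ (derivedSeries H d).map H.subtype := by
  induction d generalizing x with
  | zero =>
    refine ⟨Subgroup.closure {x}, ⟨{x}, by simp⟩, ?_⟩
    simp [← MonoidHom.range_eq_map]
  | succ d ih =>
    rw [derivedSeries_succ, Subgroup.commutator_def] at hx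
    induction hx using Subgroup.closure_induction with
    | mem x hx =>
      obtain ⟨a, ha, b, hb, rfl⟩ := hx
      obtain ⟨H, hH, haH⟩ := ih ha
      obtain ⟨K, hK, hbK⟩ := ih hb
      refine ⟨H ⊔ K, hH.sup hK, ?_⟩
      rw [derivedSeries_succ, Subgroup.map_commutator]
      exact Subgroup.commutator_mem_commutator
        (map_subtype_derivedSeries_mono le_sup_left d haH)
        (map_subtype_derivedSeries_mono le_sup_right d hbK)
    | one => exact ⟨⊥, ⟨∅, by simp⟩, one_mem _⟩
    | mul x y _ _ hx hy =>
      obtain ⟨H, hH, hxH⟩ := hx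
      obtain ⟨K, hK, hyK⟩ := hy
      exact ⟨H ⊔ K, hH.sup hK, mul_mem (map_subtype_derivedSeries_mono le_sup_left _ hxH)
        (map_subtype_derivedSeries_mono le_sup_right _ hyK)⟩
    | inv x _ hx =>
      obtain ⟨H, hH, hxH⟩ := hx
      exact ⟨H, hH, inv_mem hxH⟩

instance : IsJacobsonRing ℤ := isJacobsonRing_iff_prime_eq.2 fun P hP => by
  by_cases h : P = ⊥
  · subst h
    refine eq_bot_iff.2 fun x hx => ?_
    have := Int.isUnit_iff.1 (Ideal.mem_jacobson_bot.1 hx x)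
    rw [Ideal.mem_bot]
    nlinarith [mul_self_nonneg x, this.resolve_right (by nlinarith [mul_self_nonneg x])]
  · have := hP.isMaximal h
    exact Ideal.jacobson_eq_self_of_isMaximal

theorem Field.finite_of_moduleFinite_int (F : Type*) [Field F] [Module.Finite ℤ F] :
    Finite F := by
  obtain ⟨p, hp⟩ := CharP.exists F
  rcases CharP.char_is_prime_or_zero F p with hprime | rfl
  · have : Fact p.Prime := ⟨hprime⟩
    let := ZMod.algebra F p
    have : Module.Finite (ZMod p) F := Module.Finite.of_restrictScalars_finite ℤ _ _
    exact Module.finite_of_finite (ZMod p)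
  · have := CharP.charP_to_charZero F
    exact (Int.not_isField (isField_of_isIntegral_of_isField
      (FaithfulSMul.algebraMap_injective ℤ F) (Field.toIsField F))).elim

namespace Matrix.GeneralLinearGroup

variable {ι R S : Type*} [Fintype ι] [DecidableEq ι] [CommRing R] [CommRing S]

theorem map_injective {f : R →+* S} (hf : Function.Injective f) :
    Function.Injective (map (n := ι) f) :=
  Units.map_injective (Matrix.map_injective hf)

theorem mem_range_map_subtype {R : Subring S} {g : GL ι S}
    (h : ∀ i j, g i j ∈ R) (h' : ∀ i j, g⁻¹ i j ∈ R) : g ∈ (map (n := ι) R.subtype).range := by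
  have hinj : Function.Injective (fun M : Matrix ι ι R => M.map R.subtype) :=
    Matrix.map_injective R.subtype_injective
  refine ⟨⟨.of fun i j => ⟨g i j, h i j⟩, .of fun i j => ⟨g⁻¹ i j, h' i j⟩, hinj ?_, hinj ?_⟩,
    Units.ext rfl⟩
  · simp only [Matrix.map_mul]
    rw [Matrix.map_one _ (map_zero _) (map_one _)]
    exact g.mul_inv
  · simp only [Matrix.map_mul]
    rw [Matrix.map_one _ (map_zero _) (map_one _)]
    exact g.inv_mul

end Matrix.GeneralLinearGroup

open Matrix.GeneralLinearGroup in
theorem derivedSeries_le_ker_of_finite_field {Γ F : Type*} [Group Γ]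
    (hq : ∀ g : Γ, ∃ k, QuasiNilRec k g) [Field F] [Finite F] {n : ℕ}
    (f : Γ →* Matrix.GeneralLinearGroup (Fin n) F) :
    derivedSeries Γ (zassenhausBound n) ≤ f.ker := by
  have hsol : Group.IsSolvable f.range := isSolvable_of_forall_quasiNilRec fun g => by
    obtain ⟨g, rfl⟩ := f.rangeRestrict_surjective g
    obtain ⟨k, hk⟩ := hq g
    exact ⟨k, hk.map f.rangeRestrict_surjective⟩
  let e : Matrix.GeneralLinearGroup (Fin n) F →* Module.End (AlgebraicClosure F)
      (Fin n → AlgebraicClosure F) := (Units.coeHom _).comp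
        ((toLin (n := Fin n) (R := AlgebraicClosure F)).toMonoidHom.comp
          (map (algebraMap F (AlgebraicClosure F))))
  have he : Function.Injective e := Units.val_injective.comp
    (toLin.injective.comp (map_injective (algebraMap F _).injective))
  have key := Representation.derivedSeries_zassenhausBound_le_ker (G := f.range) n
    (e.comp f.range.subtype) (by simp)
  intro x hx
  have := key (map_derivedSeries_le_derivedSeries f.rangeRestrict _ ⟨x, hx, rfl⟩)
  exact he (this.trans e.map_one.symm)

open Matrix.GeneralLinearGroup in
theorem derivedSeries_eq_bot_of_fg {Γ K : Type*} [Group Γ] [Group.FG Γ]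
    (hq : ∀ g : Γ, ∃ k, QuasiNilRec k g) [CommRing K] [IsReduced K] {n : ℕ}
    {f : Γ →* Matrix.GeneralLinearGroup (Fin n) K} (hf : Function.Injective f) :
    derivedSeries Γ (zassenhausBound n) = ⊥ := by
  obtain ⟨S, hS⟩ := Group.fg_def.1 ‹Group.FG Γ›
  let E : Set K := ⋃ s ∈ S, Set.range (fun p : Fin n × Fin n => f s p.1 p.2) ∪
    Set.range (fun p : Fin n × Fin n => (f s)⁻¹ p.1 p.2)
  have hE : E.Finite := S.finite_toSet.biUnion fun s _ =>
    (Set.finite_range _).union (Set.finite_range _)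
  let R := Algebra.adjoin ℤ E
  have hfin : Algebra.FiniteType ℤ R :=
    R.fg_iff_finiteType.1 (Subalgebra.fg_def.2 ⟨E, hE, rfl⟩)
  have hJ : IsJacobsonRing R := isJacobsonRing_of_finiteType (A := ℤ)
  let φ := map (n := Fin n) R.toSubring.subtype
  have hφ : Function.Injective φ := map_injective R.toSubring.subtype_injective
  have hrange (g : Γ) : f g ∈ φ.range := by
    suffices h : (⊤ : Subgroup Γ) ≤ φ.range.comap f from h (Subgroup.mem_top g)
    rw [← hS, Subgroup.closure_le]
    intro s hs
    refine mem_range_map_subtype (fun i j => Algebra.subset_adjoin ?_)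
      (fun i j => Algebra.subset_adjoin ?_)
    · exact Set.mem_biUnion hs (Or.inl ⟨(i, j), rfl⟩)
    · exact Set.mem_biUnion hs (Or.inr ⟨(i, j), rfl⟩)
  let f' : Γ →* Matrix.GeneralLinearGroup (Fin n) R :=
    (MonoidHom.ofInjective hφ).symm.toMonoidHom.comp (f.codRestrict φ.range hrange)
  have hf' : Function.Injective f' := (MonoidHom.ofInjective hφ).symm.injective.comp
    fun x y hxy => hf (congrArg Subtype.val hxy)
  rw [eq_bot_iff]
  intro x hx
  refine hf' (Units.ext (Matrix.ext fun i j => ?_))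
  rw [map_one, ← sub_eq_zero, ← Ideal.mem_bot]
  have : IsReduced R := isReduced_of_injective R.val Subtype.val_injective
  have hrad : (⊥ : Ideal R).IsRadical := Ideal.isRadical_bot
  rw [← hJ.out hrad, Ideal.jacobson, Submodule.mem_sInf]
  rintro m ⟨-, hm⟩
  let := Ideal.Quotient.field m
  have := finite_of_finite_type_of_isJacobsonRing ℤ (R ⧸ m)
  have := Field.finite_of_moduleFinite_int (R ⧸ m)
  have h1 := derivedSeries_le_ker_of_finite_field hq
    ((map (Ideal.Quotient.mk m)).comp f') hx
  have h2 := congrArg (fun M : Matrix.GeneralLinearGroup (Fin n) (R ⧸ m) => M i j) h1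
  rw [← Ideal.Quotient.eq_zero_iff_mem, map_sub, sub_eq_zero]
  refine h2.trans ?_
  rw [← map_one (map (Ideal.Quotient.mk m))]
  rfl

theorem isSolvable_of_linear_of_forall_quasiNilRec {Γ K : Type*} [Group Γ]
    (hq : ∀ g : Γ, ∃ k, QuasiNilRec k g) [CommRing K] [IsReduced K] {n : ℕ}
    {f : Γ →* Matrix.GeneralLinearGroup (Fin n) K} (hf : Function.Injective f) :
    Group.IsSolvable Γ := by
  refine (Group.isSolvable_def Γ).2 ⟨zassenhausBound n, eq_bot_iff.2 fun x hx => ?_⟩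
  obtain ⟨H, hH, y, hy, rfl⟩ := exists_fg_mem_map_derivedSeries hx
  have : Group.FG H := (Group.fg_iff_subgroup_fg H).2 hH
  have h := derivedSeries_eq_bot_of_fg (Γ := H) (fun g => by
    obtain ⟨k, hk⟩ := hq g
    exact ⟨k, QuasiNilRec.of_map (f := H.subtype) H.subtype_injective hk⟩)
    (f := f.comp H.subtype) (hf.comp H.subtype_injective)
  have h1 : y = 1 := Subgroup.mem_bot.1 (h ▸ hy)
  simp [h1]

/-- a subgroup `G` of `GL_n(K)`, `K` a product of fields, all of whose
elements are quasi-nil, has a locally nilpotent normal subgroup `N` with `G/N`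
solvable. -/
theorem solvable_mod_locallyNilpotent_of_all_quasiNil {I : Type*}
    (P : I → Type*) [∀ α, Field (P α)] (n : ℕ) (hn : 1 ≤ n)
    (G : Subgroup (Matrix.GeneralLinearGroup (Fin n) (∀ α, P α)))
    (hqn : ∀ g : G, IsQuasiNil g) :
    ∃ (N : Subgroup G) (hN : N.Normal), LocallyNilpotent N ∧
      @IsSolvable (G ⧸ N) (@QuotientGroup.Quotient.group G _ N hN) := by
  have hsol : Group.IsSolvable G := isSolvable_of_linear_of_forall_quasiNilRec
    (fun g => by
      obtain ⟨k, -, hk⟩ := hqn g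
      exact ⟨k, hk.quasiNilRec⟩) G.subtype_injective
  exact ⟨⊥, Subgroup.normal_bot, fun H _ => inferInstance,
    Group.isSolvable_of_surjective (QuotientGroup.mk'_surjective ⊥)⟩
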